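/- arXiv:2510.20368 — 8 statements merged into one kernel-verified Lean document; each statement's English description precedes it below -/
import Mathlib

section
/- For every bounded maximum flow instance (G,u) and every feasible flow f, the maximum flow value satisfies ν(G,u) = val(f) + ν(G,u^f), where (G,u^f) is the residual instance on the same graph with capacities u^f. -/
open scoped ENNReal Classical

noncomputable section

/-- A maximum flow instance: a finite directed graph (parallel arcs allowed, no
self-loops) with distinct source `s` and sink `t`, a fixed-point-free reversal
involution on arcs, and capacities in `[0,∞]`. -/
structure FlowInstance (V E : Type) [Fintype V] [Fintype E] [DecidableEq V] where
  tail : E → V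
  head : E → V
  s : V
  t : V
  s_ne_t : s ≠ t
  rev : E → E
  rev_rev : ∀ e, rev (rev e) = e
  rev_ne : ∀ e, rev e ≠ e
  tail_rev : ∀ e, tail (rev e) = head e
  head_rev : ∀ e, head (rev e) = tail e
  no_loop : ∀ e, tail e ≠ head e
  u : E → ℝ≥0∞

namespace FlowInstance

variable {V E : Type} [Fintype V] [Fintype E] [DecidableEq V]

/-- The excess of a node: total inflow minus total outflow. -/
def excess (I : FlowInstance V E) (f : E → ℝ) (i : V) : ℝ :=
  ∑ e ∈ Finset.univ.filter (fun e => I.head e = i), f e -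
    ∑ e ∈ Finset.univ.filter (fun e => I.tail e = i), f e

/-- A feasible flow: nonnegative, within capacities, and conserving at every
node other than `s` and `t`. -/
def Feasible (I : FlowInstance V E) (f : E → ℝ) : Prop :=
  (∀ e, 0 ≤ f e) ∧ (∀ e, ENNReal.ofReal (f e) ≤ I.u e) ∧
    ∀ i, i ≠ I.s → i ≠ I.t → I.excess f i = 0

/-- The value of a flow. -/
def val (I : FlowInstance V E) (f : E → ℝ) : ℝ := -I.excess f I.s

/-- The set of values of feasible flows. -/
def flowValues (I : FlowInstance V E) : Set ℝ := {x | ∃ f, I.Feasible f ∧ I.val f = x}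

/-- The maximum flow value `ν(G,u)` (as a real supremum). -/
def maxFlowVal (I : FlowInstance V E) : ℝ := sSup I.flowValues

/-- The instance is bounded if `ν(G,u) < ∞`. -/
def Bounded (I : FlowInstance V E) : Prop := BddAbove I.flowValues

/-- Residual capacities `u^f_e = u_e - f_e + f_{rev e}` of a flow. -/
def residual (I : FlowInstance V E) (f : E → ℝ) : E → ℝ≥0∞ :=
  fun e => I.u e - ENNReal.ofReal (f e) + ENNReal.ofReal (f (I.rev e))

/-- The instance on the same graph with capacities replaced by `u'`. -/
def withCapacity (I : FlowInstance V E) (u' : E → ℝ≥0∞) : FlowInstance V E :=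
  { I with u := u' }

/-- An `s`–`t` cut. -/
def IsCut (I : FlowInstance V E) (S : Finset V) : Prop := I.s ∈ S ∧ I.t ∉ S

/-- The capacity `u(S, V∖S)` of a cut. -/
def cutCap (I : FlowInstance V E) (S : Finset V) : ℝ≥0∞ :=
  ∑ e ∈ Finset.univ.filter (fun e => I.tail e ∈ S ∧ I.head e ∉ S), I.u e

/-- The total residual capacity `u^f(S, V∖S)` of a cut. -/
def resCutCap (I : FlowInstance V E) (f : E → ℝ) (S : Finset V) : ℝ≥0∞ :=
  ∑ e ∈ Finset.univ.filter (fun e => I.tail e ∈ S ∧ I.head e ∉ S), I.residual f e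

/-- A directed path from `x` to `y` through pairwise distinct nodes using only
arcs from `A`. -/
def IsDiPath (I : FlowInstance V E) (A : Set E) (x y : V) : Prop :=
  ∃ (k : ℕ) (v : Fin (k + 1) → V) (es : Fin k → E),
    v 0 = x ∧ v (Fin.last k) = y ∧ Function.Injective v ∧
    ∀ i : Fin k, es i ∈ A ∧ I.tail (es i) = v i.castSucc ∧ I.head (es i) = v i.succ

/-- `A` contains a directed cycle: a head-to-tail sequence of arcs of `A` through
pairwise distinct nodes returning to its starting node. -/
def HasDiCycle (I : FlowInstance V E) (A : Set E) : Prop :=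
  ∃ (k : ℕ) (v : Fin (k + 1) → V) (es : Fin (k + 1) → E),
    Function.Injective v ∧
    ∀ i : Fin (k + 1), es i ∈ A ∧ I.tail (es i) = v i ∧ I.head (es i) = v (i + 1)

/-- The constant `Γ = 4 n²` where `n = |V|`. -/
def Gamma (I : FlowInstance V E) : ℝ := 4 * (Fintype.card V : ℝ) ^ 2

end FlowInstance

/-- `I'` extends `I`: same node set, same `s` and `t`, the arc set of `I'` contains
that of `I` (via the injection `ι`), with the same endpoints, capacities and
reversal involution on the arcs of `I`. -/
def IsExtension {V E E' : Type} [Fintype V] [Fintype E] [Fintype E'] [DecidableEq V]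
    (I : FlowInstance V E) (I' : FlowInstance V E') (ι : E → E') : Prop :=
  Function.Injective ι ∧ I'.s = I.s ∧ I'.t = I.t ∧
    (∀ e, I'.tail (ι e) = I.tail e) ∧ (∀ e, I'.head (ι e) = I.head e) ∧
    (∀ e, I'.rev (ι e) = ι (I.rev e)) ∧ (∀ e, I'.u (ι e) = I.u e)

namespace FlowInstance

variable {V E : Type} [Fintype V] [Fintype E] [DecidableEq V]

theorem sum_tail_eq_sum_head_rev (I : FlowInstance V E) (f : E → ℝ) (i : V) :
    ∑ e ∈ Finset.univ.filter (fun e => I.tail e = i), f e =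
      ∑ e ∈ Finset.univ.filter (fun e => I.head e = i), f (I.rev e) := by
  refine Finset.sum_bij' (fun e _ => I.rev e) (fun e _ => I.rev e) ?_ ?_ ?_ ?_ ?_ <;>
    simp +contextual [I.rev_rev, I.tail_rev, I.head_rev]

theorem excess_eq_sum_net (I : FlowInstance V E) (f : E → ℝ) (i : V) :
    I.excess f i =
      ∑ e ∈ Finset.univ.filter (fun e => I.head e = i), (f e - f (I.rev e)) := by
  rw [excess, sum_tail_eq_sum_head_rev, Finset.sum_sub_distrib]

/-- The nonnegative arc flow with the same net flow `f e - f (rev e)` as `f` that uses at most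
one arc of every pair `{e, rev e}`. -/
def netPart (I : FlowInstance V E) (f : E → ℝ) (e : E) : ℝ :=
  max 0 (f e - f (I.rev e))

theorem netPart_sub_netPart_rev (I : FlowInstance V E) (f : E → ℝ) (e : E) :
    I.netPart f e - I.netPart f (I.rev e) = f e - f (I.rev e) := by
  simp only [netPart, I.rev_rev]
  rcases le_total (f e) (f (I.rev e)) with h | h
  · rw [max_eq_left (by linarith), max_eq_right (by linarith)]; ring
  · rw [max_eq_right (by linarith), max_eq_left (by linarith)]; ring

theorem excess_netPart (I : FlowInstance V E) (f : E → ℝ) (i : V) :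
    I.excess (I.netPart f) i = I.excess f i := by
  simp only [excess_eq_sum_net, netPart_sub_netPart_rev]

theorem excess_add (I : FlowInstance V E) (f g : E → ℝ) (i : V) :
    I.excess (f + g) i = I.excess f i + I.excess g i := by
  simp only [excess, Pi.add_apply, Finset.sum_add_distrib]; ring

theorem excess_sub (I : FlowInstance V E) (f g : E → ℝ) (i : V) :
    I.excess (f - g) i = I.excess f i - I.excess g i := by
  simp only [excess, Pi.sub_apply, Finset.sum_sub_distrib]; ring

theorem excess_withCapacity (I : FlowInstance V E) (u' : E → ℝ≥0∞) (f : E → ℝ) (i : V) :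
    (I.withCapacity u').excess f i = I.excess f i := rfl

/-- Subtracting `f` turns feasible flows into feasible flows of the residual instance. -/
theorem Feasible.netPart_sub {I : FlowInstance V E} {f g : E → ℝ}
    (hf : I.Feasible f) (hg : I.Feasible g) :
    (I.withCapacity (I.residual f)).Feasible (I.netPart (g - f)) := by
  refine ⟨fun e => le_max_left _ _, fun e => ?_, fun i hs ht => ?_⟩
  · change ENNReal.ofReal (I.netPart (g - f) e) ≤
      I.u e - ENNReal.ofReal (f e) + ENNReal.ofReal (f (I.rev e))
    have hfr := hf.1 (I.rev e)
    have hgr := hg.1 (I.rev e)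
    calc ENNReal.ofReal (I.netPart (g - f) e)
        ≤ ENNReal.ofReal (max 0 (g e - f e) + f (I.rev e)) := by
          refine ENNReal.ofReal_le_ofReal (max_le (by positivity) ?_)
          simp only [Pi.sub_apply]
          linarith [le_max_right 0 (g e - f e)]
      _ = (ENNReal.ofReal (g e) - ENNReal.ofReal (f e)) + ENNReal.ofReal (f (I.rev e)) := by
          rw [ENNReal.ofReal_add (le_max_left _ _) hfr, ← ENNReal.ofReal_sub _ (hf.1 e),
            max_comm, ENNReal.ofReal_max, ENNReal.ofReal_zero, max_eq_left zero_le]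
      _ ≤ _ := by gcongr; exact hg.2.1 e
  · rw [excess_withCapacity, excess_netPart, excess_sub, hg.2.2 i hs ht, hf.2.2 i hs ht, sub_zero]

/-- Adding `f` turns feasible flows of the residual instance into feasible flows. -/
theorem Feasible.netPart_add {I : FlowInstance V E} {f h : E → ℝ}
    (hf : I.Feasible f) (hh : (I.withCapacity (I.residual f)).Feasible h) :
    I.Feasible (I.netPart (f + h)) := by
  refine ⟨fun e => le_max_left _ _, fun e => ?_, fun i hs ht => ?_⟩
  · have hc : ENNReal.ofReal (h e) ≤
        I.u e - ENNReal.ofReal (f e) + ENNReal.ofReal (f (I.rev e)) := hh.2.1 e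
    have hhr := hh.1 (I.rev e)
    have hsum : ENNReal.ofReal (f e + h e) ≤ I.u e + ENNReal.ofReal (f (I.rev e)) :=
      calc ENNReal.ofReal (f e + h e)
          = ENNReal.ofReal (f e) + ENNReal.ofReal (h e) := ENNReal.ofReal_add (hf.1 e) (hh.1 e)
        _ ≤ ENNReal.ofReal (f e) +
              (I.u e - ENNReal.ofReal (f e) + ENNReal.ofReal (f (I.rev e))) := by gcongr
        _ = I.u e + ENNReal.ofReal (f (I.rev e)) := by
          rw [← add_assoc, add_tsub_cancel_of_le (hf.2.1 e)]
    calc ENNReal.ofReal (I.netPart (f + h) e)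
        ≤ ENNReal.ofReal (f e + h e - f (I.rev e)) := by
          rw [netPart, max_comm, ENNReal.ofReal_max, ENNReal.ofReal_zero, max_eq_left zero_le]
          refine ENNReal.ofReal_le_ofReal ?_
          simp only [Pi.add_apply]
          linarith
      _ = ENNReal.ofReal (f e + h e) - ENNReal.ofReal (f (I.rev e)) :=
          ENNReal.ofReal_sub _ (hf.1 _)
      _ ≤ I.u e := tsub_le_iff_right.2 hsum
  · rw [excess_netPart, excess_add, hf.2.2 i hs ht, ← I.excess_withCapacity (I.residual f),
      hh.2.2 i hs ht, add_zero]

theorem flowValues_eq_image_residual {I : FlowInstance V E} {f : E → ℝ} (hf : I.Feasible f) :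
    I.flowValues = (I.val f + ·) '' (I.withCapacity (I.residual f)).flowValues := by
  ext x
  constructor
  · rintro ⟨g, hg, rfl⟩
    refine ⟨_, ⟨_, hf.netPart_sub hg, rfl⟩, ?_⟩
    change -I.excess f I.s + -I.excess (I.netPart (g - f)) I.s = -I.excess g I.s
    rw [excess_netPart, excess_sub]; ring
  · rintro ⟨_, ⟨h, hh, rfl⟩, rfl⟩
    refine ⟨_, hf.netPart_add hh, ?_⟩
    change -I.excess (I.netPart (f + h)) I.s = -I.excess f I.s + -I.excess h I.s
    rw [excess_netPart, excess_add]; ring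

end FlowInstance

/-- For every bounded maximum flow instance `(G,u)` and every feasible flow `f`,
`ν(G,u) = val(f) + ν(G,u^f)`, where `(G,u^f)` is the residual instance. -/
theorem maxFlowVal_eq_val_add_residual_maxFlowVal
    {V E : Type} [Fintype V] [Fintype E] [DecidableEq V]
    (I : FlowInstance V E) (hB : I.Bounded)
    (f : E → ℝ) (hf : I.Feasible f) :
    I.maxFlowVal = I.val f + (I.withCapacity (I.residual f)).maxFlowVal := by
  have himage := FlowInstance.flowValues_eq_image_residual hf
  have hne : (I.withCapacity (I.residual f)).flowValues.Nonempty := by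
    have : I.flowValues.Nonempty := ⟨_, f, hf, rfl⟩
    rw [himage] at this
    exact this.of_image
  have hbdd : BddAbove (I.withCapacity (I.residual f)).flowValues := by
    rw [FlowInstance.Bounded, himage] at hB
    exact (OrderIso.addLeft (I.val f)).bddAbove_image.1 hB
  rw [FlowInstance.maxFlowVal, FlowInstance.maxFlowVal, himage]
  exact ((OrderIso.addLeft (I.val f)).map_csSup' hne hbdd).symm
end
end

section
/- Let (G,u) be a bounded maximum flow instance with n = |V| ≥ 1 and Γ := 4n², and let (G',u') be a maximum flow instance on the same node set with the same s and t whose arc set E' contains E, with u'_e = u_e and the same reversal involution on arcs of E. Let ε ≥ 0 and 0 ≤ ε' ≤ ε/2, let f be an ε-optimal feasible flow in (G,u), let f' be an ε'-optimal feasible flow in (G',u'), and assume |f_e − f_{rev(e)} − f'_e + f'_{rev(e)}| ≤ 2nε for all e ∈ E. Then every e ∈ E with u^f_e ≥ Γε satisfies u'^{f'}_e ≥ Γε' (i.e., (f,ε)-abundant arcs remain (f',ε')-abundant); consequently every e ∈ E with u^f_e ≥ Γε and u^f_{rev(e)} ≥ Γε satisfies u'^{f'}_e ≥ Γε' and u'^{f'}_{rev(e)}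 ≥ Γε' (i.e., (f,ε)-free arcs remain (f',ε')-free). -/
open scoped ENNReal Classical

noncomputable section

/-- With finite capacity the residual capacity is the real number `u_e - f_e + f_{rev e}`. -/
theorem FlowInstance.Feasible.residual_eq_ofReal {V E : Type} [Fintype V] [Fintype E]
    [DecidableEq V] {I : FlowInstance V E} {f : E → ℝ} (hf : I.Feasible f) {e : E}
    (he : I.u e ≠ ∞) :
    I.residual f e = ENNReal.ofReal ((I.u e).toReal - f e + f (I.rev e)) := by
  have hle : f e ≤ (I.u e).toReal := (ENNReal.ofReal_le_iff_le_toReal he).1 (hf.2.1 e)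
  rw [ENNReal.ofReal_add (sub_nonneg.2 hle) (hf.1 _), ENNReal.ofReal_sub _ (hf.1 e),
    ENNReal.ofReal_toReal he, FlowInstance.residual]

/-- If the net flows of feasible flows `f` and `g` on an arc differ by at most `c - d`, then
residual capacity at least `c` under `f` gives residual capacity at least `d` under `g`. -/
theorem IsExtension.ofReal_le_residual {V E E' : Type} [Fintype V] [Fintype E] [Fintype E']
    [DecidableEq V] {I : FlowInstance V E} {I' : FlowInstance V E'} {ι : E → E'}
    (hext : IsExtension I I' ι) {f : E → ℝ} (hf : I.Feasible f) {g : E' → ℝ}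
    (hg : I'.Feasible g) {c d : ℝ} {e : E}
    (hclose : |f e - f (I.rev e) - g (ι e) + g (ι (I.rev e))| ≤ c - d)
    (h : ENNReal.ofReal c ≤ I.residual f e) :
    ENNReal.ofReal d ≤ I'.residual g (ι e) := by
  obtain ⟨-, -, -, -, -, hrev, hu⟩ := hext
  by_cases he : I.u e = ∞
  · simp [FlowInstance.residual, hu, he]
  · have hnonneg : 0 ≤ (I.u e).toReal - f e + f (I.rev e) :=
      add_nonneg (sub_nonneg.2 ((ENNReal.ofReal_le_iff_le_toReal he).1 (hf.2.1 e))) (hf.1 _)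
    rw [hf.residual_eq_ofReal he, ENNReal.ofReal_le_ofReal_iff hnonneg] at h
    rw [hg.residual_eq_ofReal (by rwa [hu]), hrev, hu]
    exact ENNReal.ofReal_le_ofReal (by linarith [(abs_le.1 hclose).1])

/-- Abundant arcs stay abundant (and free arcs stay free) when passing from an
`ε`-optimal flow `f` in `(G,u)` to an `ε'`-optimal flow `g` in an extension
`(G',u')`, provided `ε' ≤ ε/2` and the two flows are `2nε`-close in net value on
every arc of `G`. -/
theorem abundant_stays_abundant
    {V E E' : Type} [Fintype V] [Fintype E] [Fintype E'] [DecidableEq V]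
    (I : FlowInstance V E) (I' : FlowInstance V E') (ι : E → E')
    (hext : IsExtension I I' ι) (hB : I.Bounded)
    (ε ε' : ℝ) (hε : 0 ≤ ε) (hε' : 0 ≤ ε') (hle : ε' ≤ ε / 2)
    (f : E → ℝ) (hf : I.Feasible f) (hfopt : I.maxFlowVal - ε ≤ I.val f)
    (g : E' → ℝ) (hg : I'.Feasible g) (hgopt : I'.maxFlowVal - ε' ≤ I'.val g)
    (hclose : ∀ e, |f e - f (I.rev e) - g (ι e) + g (ι (I.rev e))| ≤
      2 * (Fintype.card V : ℝ) * ε) :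
    (∀ e, ENNReal.ofReal (I.Gamma * ε) ≤ I.residual f e →
      ENNReal.ofReal (I.Gamma * ε') ≤ I'.residual g (ι e)) ∧
    ∀ e, ENNReal.ofReal (I.Gamma * ε) ≤ I.residual f e →
      ENNReal.ofReal (I.Gamma * ε) ≤ I.residual f (I.rev e) →
      ENNReal.ofReal (I.Gamma * ε') ≤ I'.residual g (ι e) ∧
      ENNReal.ofReal (I.Gamma * ε') ≤ I'.residual g (ι (I.rev e)) := by
  have hcard : (1 : ℝ) ≤ Fintype.card V := by
    exact_mod_cast Fintype.card_pos_iff.2 ⟨I.s⟩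
  have hgap : 2 * (Fintype.card V : ℝ) * ε ≤ I.Gamma * ε - I.Gamma * ε' := by
    have hsq : (Fintype.card V : ℝ) * ε ≤ (Fintype.card V : ℝ) ^ 2 * ε :=
      mul_le_mul_of_nonneg_right (le_self_pow₀ hcard two_ne_zero) hε
    have hhalf : (Fintype.card V : ℝ) ^ 2 * ε' ≤ (Fintype.card V : ℝ) ^ 2 * (ε / 2) :=
      mul_le_mul_of_nonneg_left hle (sq_nonneg _)
    simp only [FlowInstance.Gamma]
    linarith
  have key : ∀ e, ENNReal.ofReal (I.Gamma * ε) ≤ I.residual f e →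
      ENNReal.ofReal (I.Gamma * ε') ≤ I'.residual g (ι e) := fun e =>
    hext.ofReal_le_residual hf hg ((hclose e).trans hgap)
  exact ⟨key, fun e he hr => ⟨key e he, key _ hr⟩⟩
end
end

section
/- Let (G,u) be a maximum flow instance and let f be a feasible flow whose support supp(f) := {e ∈ E : f_e ≠ 0} contains no directed cycle and contains no directed path from t to s. Then f_e ≤ val(f) for every arc e ∈ E. -/
open scoped ENNReal Classical

noncomputable section

namespace FlowInstance

variable {V E : Type} [Fintype V] [Fintype E] [DecidableEq V]

/-- The node `y` is the head of an arc of `A` with tail `x`. -/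
def Step (I : FlowInstance V E) (A : Set E) (x y : V) : Prop :=
  ∃ e ∈ A, I.tail e = x ∧ I.head e = y

/-- A nonempty directed path can be shortened to start at any of its nodes. -/
theorem isDiPath_suffix (I : FlowInstance V E) {A : Set E} {k : ℕ} {v : Fin (k + 1) → V}
    {es : Fin k → E} (hv : Function.Injective v)
    (h : ∀ i : Fin k, es i ∈ A ∧ I.tail (es i) = v i.castSucc ∧ I.head (es i) = v i.succ)
    (i : Fin (k + 1)) : I.IsDiPath A (v i) (v (Fin.last k)) := by
  obtain ⟨i, hi⟩ := i
  obtain ⟨m, rfl⟩ := Nat.exists_eq_add_of_le (Nat.lt_succ_iff.mp hi)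
  refine ⟨m, fun j => v ⟨i + j, by omega⟩, fun j => es ⟨i + j, by omega⟩, rfl, rfl, ?_, ?_⟩
  · intro a b hab
    have := congrArg Fin.val (hv hab)
    ext
    simpa using this
  · intro j
    exact h ⟨i + j, by omega⟩

theorem isDiPath_of_reflTransGen (I : FlowInstance V E) {A : Set E} {x y : V}
    (h : Relation.ReflTransGen (I.Step A) x y) : I.IsDiPath A x y := by
  induction h using Relation.ReflTransGen.head_induction_on with
  | refl =>
    exact ⟨0, fun _ => y, Fin.elim0, rfl, rfl, fun i j _ => Subsingleton.elim (α := Fin 1) i j,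
      fun i => i.elim0⟩
  | @head x z hxz _ ih =>
    obtain ⟨e, heA, rfl, rfl⟩ := hxz
    obtain ⟨k, v, es, h0, rfl, hv, hes⟩ := ih
    by_cases hx : I.tail e ∈ Set.range v
    · obtain ⟨i, hi⟩ := hx
      exact hi ▸ I.isDiPath_suffix hv hes i
    · refine ⟨k + 1, Fin.cons (I.tail e) v, Fin.cons e es, rfl, ?_,
        Fin.cons_injective_iff.2 ⟨hx, hv⟩, ?_⟩
      · rw [← Fin.succ_last, Fin.cons_succ]
      · intro i
        induction i using Fin.cases with
        | zero => simp [heA, h0]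
        | succ i => simpa [← Fin.succ_castSucc] using hes i

theorem hasDiCycle_of_reflTransGen (I : FlowInstance V E) {A : Set E} {e : E} (he : e ∈ A)
    (h : Relation.ReflTransGen (I.Step A) (I.head e) (I.tail e)) : I.HasDiCycle A := by
  obtain ⟨k, v, es, h0, hk, hv, hes⟩ := I.isDiPath_of_reflTransGen h
  refine ⟨k, v, Fin.snoc es e, hv, fun i => ?_⟩
  induction i using Fin.lastCases with
  | last => simp [he, h0, hk]
  | cast i => simpa using hes i

theorem sum_excess (I : FlowInstance V E) (f : E → ℝ) (S : Finset V) :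
    ∑ i ∈ S, I.excess f i =
      ∑ e, ((if I.head e ∈ S then f e else 0) - if I.tail e ∈ S then f e else 0) := by
  simp only [excess, Finset.sum_sub_distrib, Finset.sum_filter]
  rw [Finset.sum_comm, Finset.sum_comm (s := S)]
  simp

theorem sum_excess_univ (I : FlowInstance V E) (f : E → ℝ) : ∑ i, I.excess f i = 0 := by
  simp [sum_excess]

/-- If no flow enters `S`, then the flow on an arc leaving `S` is at most the net flow
out of `S`. -/
theorem sum_excess_le_neg (I : FlowInstance V E) {f : E → ℝ} (hf : ∀ e, 0 ≤ f e)
    {S : Finset V} (hS : ∀ e, f e ≠ 0 → I.head e ∈ S → I.tail e ∈ S) {e : E}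
    (he : f e ≠ 0 → I.tail e ∈ S ∧ I.head e ∉ S) :
    ∑ i ∈ S, I.excess f i ≤ -f e := by
  have key (a : E) :
      (if I.head a ∈ S then f a else 0) - (if I.tail a ∈ S then f a else 0) ≤ 0 := by
    have := hf a
    by_cases h0 : f a = 0
    · simp [h0]
    · have := hS a h0
      split_ifs <;> first | linarith | tauto
  rw [sum_excess]
  refine (Finset.sum_le_sum_of_subset_of_nonpos' (Finset.subset_univ {e}) ?_).trans ?_
  · exact fun a _ _ => key a
  · by_cases h0 : f e = 0
    · simp [h0]
    · simp [he h0]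

end FlowInstance

/-- If the support of a feasible flow contains no directed cycle and no directed
path from `t` to `s`, then `f_e ≤ val(f)` for every arc. -/
theorem flow_le_val_of_acyclic
    {V E : Type} [Fintype V] [Fintype E] [DecidableEq V]
    (I : FlowInstance V E)
    (f : E → ℝ) (hf : I.Feasible f)
    (hcyc : ¬ I.HasDiCycle {e | f e ≠ 0})
    (hts : ¬ I.IsDiPath {e | f e ≠ 0} I.t I.s) :
    ∀ e, f e ≤ I.val f := by
  obtain ⟨hnn, -, hcons⟩ := hf
  have sum_eq (S : Finset V) (hs : I.s ∈ S) (ht : I.t ∉ S) :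
      ∑ i ∈ S, I.excess f i = -I.val f := by
    rw [Finset.sum_eq_single_of_mem I.s hs
      fun i hi his => hcons i his (fun h => ht (h ▸ hi))]
    simp [FlowInstance.val]
  have sum_zero (S : Finset V) (hs : I.s ∉ S) (ht : I.t ∉ S) :
      ∑ i ∈ S, I.excess f i = 0 :=
    Finset.sum_eq_zero fun i hi =>
      hcons i (fun h => hs (h ▸ hi)) (fun h => ht (h ▸ hi))
  set R := Relation.ReflTransGen (I.Step {e | f e ≠ 0})
  have step (a : E) (ha : f a ≠ 0) : R (I.tail a) (I.head a) := .single ⟨a, ha, rfl, rfl⟩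
  have acyc (a : E) (ha : f a ≠ 0) : ¬ R (I.head a) (I.tail a) :=
    fun h => hcyc (I.hasDiCycle_of_reflTransGen ha h)
  have not_ts : ¬ R I.t I.s := fun h => hts (I.isDiPath_of_reflTransGen h)
  intro e
  by_cases he : f e = 0
  · have h := I.sum_excess_le_neg hnn (S := {v | R v I.s}) (e := e)
      (by simpa using fun a ha h => (step a ha).trans h) (fun h => absurd he h)
    rw [sum_eq _ (by simpa using Relation.ReflTransGen.refl) (by simpa using not_ts)] at h
    linarith
  have hpos : 0 < f e := (hnn e).lt_of_ne' he
  by_cases ht : R I.t (I.tail e)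
  · have h := I.sum_excess_le_neg hnn (S := ({v | R (I.head e) v} : Finset V)ᶜ) (e := e)
      (by simpa using fun a ha h h' => h (h'.trans (step a ha)))
      (fun _ => ⟨by simpa using acyc e he, by simpa using Relation.ReflTransGen.refl⟩)
    have htot := Finset.sum_add_sum_compl ({v | R (I.head e) v} : Finset V) (I.excess f)
    rw [I.sum_excess_univ, sum_zero] at htot
    · linarith
    · simpa using fun h => not_ts ((ht.trans (step e he)).trans h)
    · simpa using fun h => acyc e he (h.trans ht)
  · have h := I.sum_excess_le_neg hnn (S := {v | R v (I.tail e)}) (e := e)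
      (by simpa using fun a ha h => (step a ha).trans h)
      (fun _ => ⟨by simpa using Relation.ReflTransGen.refl, by simpa using acyc e he⟩)
    by_cases hs : R I.s (I.tail e)
    · rw [sum_eq _ (by simpa using hs) (by simpa using ht)] at h
      linarith
    · rw [sum_zero _ (by simpa using hs) (by simpa using ht)] at h
      linarith
end
end

section
/- Let (G,u) be a maximum flow instance and let f be an extreme point of the flow polyhedron FlowP(G,u) whose support contains no directed cycle, and set A := {e ∈ E : 0 < f_e < u_e}. Then: (a) there are no distinct arcs e_1,…,e_k ∈ A with k ≥ 2 and nodes v_0,v_1,…,v_k with v_0 = v_k such that each e_i is an arc between v_{i−1} and v_i (in either direction); and (b) there is no sequence of arcs of A forming an undirected walk joining s and t. In other words, the arcs of A form a forest in the underlying undirected multigraph and s and t lie in different components of it. -/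
open scoped ENNReal Classical

noncomputable section

open Filter Topology

namespace FlowInstance

section

variable {V E : Type} [Fintype V] [Fintype E] [DecidableEq V]

theorem excess_add_smul (I : FlowInstance V E) (f d : E → ℝ) (c : ℝ) (i : V) :
    I.excess (f + c • d) i = I.excess f i + c * I.excess d i := by
  simp only [excess, Pi.add_apply, Pi.smul_apply, smul_eq_mul, Finset.sum_add_distrib,
    ← Finset.mul_sum]
  ring

theorem excess_single (I : FlowInstance V E) (e : E) (x : ℝ) (i : V) :
    I.excess (Pi.single e x) i =
      (if I.head e = i then x else 0) - (if I.tail e = i then x else 0) := by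
  simp [excess]

theorem excess_sum {ι : Type*} (I : FlowInstance V E) (S : Finset ι) (g : ι → E → ℝ) (i : V) :
    I.excess (∑ j ∈ S, g j) i = ∑ j ∈ S, I.excess (g j) i := by
  simp only [excess, Finset.sum_apply, Finset.sum_sub_distrib]
  congr 1 <;> exact Finset.sum_comm

/-- The signed incidence vector of an undirected walk: each traversal of an arc counts `1` if
the arc is traversed forwards and `-1` if backwards. -/
def walkVector (I : FlowInstance V E) {k : ℕ} (es : Fin k → E) (v : Fin (k + 1) → V) :
    E → ℝ :=
  ∑ i, Pi.single (es i) (if I.tail (es i) = v i.castSucc then 1 else -1)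

theorem excess_walkVector (I : FlowInstance V E) {k : ℕ} (es : Fin k → E)
    (v : Fin (k + 1) → V)
    (h : ∀ i, (I.tail (es i) = v i.castSucc ∧ I.head (es i) = v i.succ) ∨
      (I.tail (es i) = v i.succ ∧ I.head (es i) = v i.castSucc)) (w : V) :
    I.excess (I.walkVector es v) w =
      (if v (Fin.last k) = w then 1 else 0) - (if v 0 = w then 1 else 0) := by
  have telescope : ∀ (n : ℕ) (g : Fin (n + 1) → ℝ),
      ∑ i : Fin n, (g i.succ - g i.castSucc) = g (Fin.last n) - g 0 := by
    intro n g
    induction n with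
    | zero => simp
    | succ n ih =>
      rw [Fin.sum_univ_castSucc]
      have := ih fun i => g i.castSucc
      simp only [← Fin.succ_castSucc, Fin.castSucc_zero] at this
      rw [this, Fin.succ_last]
      ring
  rw [walkVector, excess_sum, ← telescope k fun j => if v j = w then 1 else 0]
  refine Finset.sum_congr rfl fun i _ => ?_
  have hne := I.no_loop (es i)
  rw [excess_single]
  rcases h i with ⟨h₁, h₂⟩ | ⟨h₁, h₂⟩
  · simp [h₁, h₂]
  · rw [h₁, h₂] at hne
    rw [h₁, h₂, if_neg hne]
    split_ifs <;> norm_num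

theorem exists_arc_of_walkVector_ne_zero (I : FlowInstance V E) {k : ℕ} {es : Fin k → E}
    {v : Fin (k + 1) → V} {e : E} (he : I.walkVector es v e ≠ 0) : ∃ i, es i = e := by
  rw [walkVector, Finset.sum_apply] at he
  obtain ⟨i, -, hi⟩ := Finset.exists_ne_zero_of_sum_ne_zero he
  refine ⟨i, ?_⟩
  by_contra hne
  exact hi (Pi.single_eq_of_ne (Ne.symm hne) _)

theorem walkVector_ne_zero (I : FlowInstance V E) {k : ℕ} {es : Fin k → E}
    (hes : Function.Injective es) (v : Fin (k + 1) → V) (i : Fin k) :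
    I.walkVector es v (es i) ≠ 0 := by
  rw [walkVector, Finset.sum_apply, Finset.sum_eq_single i]
  · rw [Pi.single_eq_same]
    split_ifs <;> norm_num
  · intro j _ hj
    exact Pi.single_eq_of_ne (fun h => hj (hes h.symm)) _
  · simp

/-- A vector conserving flow off `s` and `t` and supported on arcs strictly between their
bounds in a basic flow vanishes. -/
theorem eq_zero_of_mem_extremePoints (I : FlowInstance V E) {f d : E → ℝ}
    (hf : f ∈ Set.extremePoints ℝ {g : E → ℝ | I.Feasible g})
    (hd : ∀ i, i ≠ I.s → i ≠ I.t → I.excess d i = 0)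
    (hsupp : ∀ e, d e ≠ 0 → 0 < f e ∧ ENNReal.ofReal (f e) < I.u e) : d = 0 := by
  obtain ⟨⟨hnn, hcap, hcons⟩, hext⟩ := mem_extremePoints.1 hf
  have hfeas : ∀ᶠ ε : ℝ in 𝓝 0, I.Feasible (f + ε • d) := by
    have harc : ∀ᶠ ε : ℝ in 𝓝 0, ∀ e,
        0 ≤ f e + ε * d e ∧ ENNReal.ofReal (f e + ε * d e) ≤ I.u e := by
      refine eventually_all.2 fun e => ?_
      by_cases hde : d e = 0
      · exact Eventually.of_forall fun ε => by simpa [hde] using ⟨hnn e, hcap e⟩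
      · obtain ⟨hpos, hlt⟩ := hsupp e hde
        have hlim : Tendsto (fun ε : ℝ => f e + ε * d e) (𝓝 0) (𝓝 (f e)) := by
          have hcont : Continuous fun ε : ℝ => f e + ε * d e := by fun_prop
          simpa using hcont.tendsto 0
        filter_upwards [hlim.eventually_const_lt hpos,
          (ENNReal.tendsto_ofReal hlim).eventually_lt_const hlt] with ε h₁ h₂
        exact ⟨h₁.le, h₂.le⟩
    filter_upwards [harc] with ε hε
    refine ⟨fun e => (hε e).1, fun e => (hε e).2, fun i hs ht => ?_⟩
    rw [excess_add_smul, hcons i hs ht, hd i hs ht, mul_zero, add_zero]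
  have hneg : ∀ᶠ ε : ℝ in 𝓝 0, I.Feasible (f + (-ε) • d) :=
    (by simpa using (continuous_neg (G := ℝ)).tendsto 0 :
      Tendsto (fun ε : ℝ => -ε) (𝓝 0) (𝓝 0)).eventually hfeas
  obtain ⟨ε, ⟨h₁, h₂⟩, hε⟩ := (((hfeas.and hneg).filter_mono nhdsWithin_le_nhds).and
    (self_mem_nhdsWithin : Set.Ioi (0 : ℝ) ∈ 𝓝[>] 0)).exists
  have hseg : f ∈ openSegment ℝ (f + ε • d) (f + (-ε) • d) := by
    refine ⟨1 / 2, 1 / 2, by norm_num, by norm_num, by norm_num, ?_⟩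
    ext e
    simp only [Pi.add_apply, Pi.smul_apply, smul_eq_mul]
    ring
  have heq := (hext _ h₁ _ h₂ hseg).1
  exact (smul_eq_zero.1 (add_eq_left.1 heq)).resolve_left (ne_of_gt hε)

end

end FlowInstance

/-- For a basic (extreme point) flow with acyclic support, the arcs strictly
between their capacity bounds form a forest in the underlying undirected
multigraph, and `s` and `t` lie in different components of it: (a) no closed
undirected walk uses `k ≥ 2` distinct such arcs; (b) no undirected walk of such
arcs joins `s` and `t`. -/
theorem basic_acyclic_fractional_arcs_forest
    {V E : Type} [Fintype V] [Fintype E] [DecidableEq V]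
    (I : FlowInstance V E)
    (f : E → ℝ) (hf : f ∈ Set.extremePoints ℝ {g : E → ℝ | I.Feasible g})
    (hcyc : ¬ I.HasDiCycle {e | f e ≠ 0}) :
    (¬ ∃ (k : ℕ) (es : Fin k → E) (v : Fin (k + 1) → V),
      2 ≤ k ∧ Function.Injective es ∧ v 0 = v (Fin.last k) ∧
      ∀ i : Fin k,
        (0 < f (es i) ∧ ENNReal.ofReal (f (es i)) < I.u (es i)) ∧
        ((I.tail (es i) = v i.castSucc ∧ I.head (es i) = v i.succ) ∨
          (I.tail (es i) = v i.succ ∧ I.head (es i) = v i.castSucc))) ∧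
    ¬ ∃ (k : ℕ) (es : Fin k → E) (v : Fin (k + 1) → V),
      v 0 = I.s ∧ v (Fin.last k) = I.t ∧
      ∀ i : Fin k,
        (0 < f (es i) ∧ ENNReal.ofReal (f (es i)) < I.u (es i)) ∧
        ((I.tail (es i) = v i.castSucc ∧ I.head (es i) = v i.succ) ∨
          (I.tail (es i) = v i.succ ∧ I.head (es i) = v i.castSucc)) := by
  refine ⟨?_, ?_⟩
  · rintro ⟨k, es, v, hk, hes, hclosed, h⟩
    have hzero : I.walkVector es v = 0 := by
      refine I.eq_zero_of_mem_extremePoints hf (fun w _ _ => ?_) fun e he => ?_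
      · rw [I.excess_walkVector es v (fun i => (h i).2), hclosed, sub_self]
      · obtain ⟨i, rfl⟩ := I.exists_arc_of_walkVector_ne_zero he
        exact (h i).1
    exact I.walkVector_ne_zero hes v ⟨0, by omega⟩ (congrFun hzero _)
  · rintro ⟨k, es, v, hs, ht, h⟩
    have hexc := I.excess_walkVector es v (fun i => (h i).2)
    rw [hs, ht] at hexc
    have hzero : I.walkVector es v = 0 := by
      refine I.eq_zero_of_mem_extremePoints hf (fun w hws hwt => ?_) fun e he => ?_
      · rw [hexc, if_neg hwt.symm, if_neg hws.symm, sub_self]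
      · obtain ⟨i, rfl⟩ := I.exists_arc_of_walkVector_ne_zero he
        exact (h i).1
    have ht' := hexc I.t
    rw [hzero, if_pos rfl, if_neg I.s_ne_t] at ht'
    simp [FlowInstance.excess] at ht'
end
end

section
/- Every rooted witness list L on a finite set V is path-structured: for every (a_i,b_i) ∈ E_*(L), the walk walk_L(a_i,b_i) visits pairwise distinct vertices, i.e., it is a path. -/
open scoped Classical

noncomputable section

/-- A witness list on a finite set `V`: a sequence of triples `(aᵢ,bᵢ,wᵢ)` with
`aᵢ ≠ bᵢ`, pairwise distinct pairs `(aᵢ,bᵢ)`, and such that whenever `wᵢ ≠ bᵢ`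
the pairs `(aᵢ,wᵢ)` and `(wᵢ,bᵢ)` occur at earlier indices. -/
structure WitnessList (V : Type) where
  K : ℕ
  a : Fin K → V
  b : Fin K → V
  w : Fin K → V
  ne : ∀ i, a i ≠ b i
  distinct : ∀ i j, a i = a j → b i = b j → i = j
  wit : ∀ i, w i ≠ b i →
    ∃ j k : Fin K, j < i ∧ k < i ∧ a j = a i ∧ b j = w i ∧ a k = w i ∧ b k = b i

namespace WitnessList

variable {V : Type}

/-- The (unique) earlier index carrying the pair `(aᵢ, wᵢ)`. -/
def jdx (L : WitnessList V) (i : Fin L.K) (h : L.w i ≠ L.b i) : Fin L.K :=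
  (L.wit i h).choose

/-- The (unique) earlier index carrying the pair `(wᵢ, bᵢ)`. -/
def kdx (L : WitnessList V) (i : Fin L.K) (h : L.w i ≠ L.b i) : Fin L.K :=
  (L.wit i h).choose_spec.choose

theorem jdx_lt (L : WitnessList V) (i : Fin L.K) (h : L.w i ≠ L.b i) :
    L.jdx i h < i :=
  (L.wit i h).choose_spec.choose_spec.1

theorem kdx_lt (L : WitnessList V) (i : Fin L.K) (h : L.w i ≠ L.b i) :
    L.kdx i h < i :=
  (L.wit i h).choose_spec.choose_spec.2.1

/-- The walk associated to the transitive arc at index `i`: the single arc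
`(aᵢ,bᵢ)` if `wᵢ = bᵢ`, and otherwise the concatenation of the walks of
`(aᵢ,wᵢ)` and `(wᵢ,bᵢ)`. -/
def walk (L : WitnessList V) (i : Fin L.K) : List (V × V) :=
  if h : L.w i = L.b i then [(L.a i, L.b i)]
  else L.walk (L.jdx i h) ++ L.walk (L.kdx i h)
termination_by i.1
decreasing_by
  · exact L.jdx_lt i h
  · exact L.kdx_lt i h

/-- The pair at index `i` is `aᵢ`-out rooted: either it is an arc of `L`
(`wᵢ = bᵢ`), or `(wᵢ,bᵢ)` is an arc of `L` and `(aᵢ,wᵢ)` is `aᵢ`-out rooted. -/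
def OutRooted (L : WitnessList V) (i : Fin L.K) : Prop :=
  if h : L.w i = L.b i then True
  else (∃ j : Fin L.K, L.w j = L.b j ∧ L.a j = L.w i ∧ L.b j = L.b i) ∧
    L.OutRooted (L.jdx i h)
termination_by i.1
decreasing_by exact L.jdx_lt i h

/-- The pair at index `i` is `bᵢ`-in rooted: either it is an arc of `L`
(`wᵢ = bᵢ`), or `(aᵢ,wᵢ)` is an arc of `L` and `(wᵢ,bᵢ)` is `bᵢ`-in rooted. -/
def InRooted (L : WitnessList V) (i : Fin L.K) : Prop :=
  if h : L.w i = L.b i then True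
  else (∃ j : Fin L.K, L.w j = L.b j ∧ L.a j = L.a i ∧ L.b j = L.w i) ∧
    L.InRooted (L.kdx i h)
termination_by i.1
decreasing_by exact L.kdx_lt i h

theorem a_jdx (L : WitnessList V) (i : Fin L.K) (h : L.w i ≠ L.b i) :
    L.a (L.jdx i h) = L.a i :=
  (L.wit i h).choose_spec.choose_spec.2.2.1

theorem b_jdx (L : WitnessList V) (i : Fin L.K) (h : L.w i ≠ L.b i) :
    L.b (L.jdx i h) = L.w i :=
  (L.wit i h).choose_spec.choose_spec.2.2.2.1

theorem a_kdx (L : WitnessList V) (i : Fin L.K) (h : L.w i ≠ L.b i) :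
    L.a (L.kdx i h) = L.w i :=
  (L.wit i h).choose_spec.choose_spec.2.2.2.2.1

theorem b_kdx (L : WitnessList V) (i : Fin L.K) (h : L.w i ≠ L.b i) :
    L.b (L.kdx i h) = L.b i :=
  (L.wit i h).choose_spec.choose_spec.2.2.2.2.2

theorem walk_of_eq (L : WitnessList V) (i : Fin L.K) (h : L.w i = L.b i) :
    L.walk i = [(L.a i, L.b i)] := by
  rw [walk, dif_pos h]

theorem walk_of_ne (L : WitnessList V) (i : Fin L.K) (h : L.w i ≠ L.b i) :
    L.walk i = L.walk (L.jdx i h) ++ L.walk (L.kdx i h) := by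
  rw [walk, dif_neg h]

/-- In an out rooted pair `(aᵢ,bᵢ)`, every vertex `x ≠ aᵢ` of the walk is the head of a
transitive arc `(aᵢ,x)` occurring no later than `i`, so the walk is a path. -/
theorem OutRooted.nodup_and_mem (L : WitnessList V) (i : Fin L.K) (hi : L.OutRooted i) :
    ((L.walk i).map Prod.fst ++ [L.b i]).Nodup ∧
      ∀ x ∈ (L.walk i).map Prod.fst ++ [L.b i],
        x = L.a i ∨ ∃ j ≤ i, L.a j = L.a i ∧ L.b j = x := by
  induction i using WellFoundedLT.induction with
  | ind i ih =>
    by_cases h : L.w i = L.b i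
    · rw [L.walk_of_eq i h]
      refine ⟨by simpa using L.ne i, fun x hx => ?_⟩
      have hx' : x = L.a i ∨ x = L.b i := by simpa using hx
      exact hx'.imp_right fun hb => ⟨i, le_rfl, rfl, hb.symm⟩
    · rw [OutRooted, dif_neg h] at hi
      obtain ⟨⟨k, hk, hka, hkb⟩, hj⟩ := hi
      obtain ⟨hnodup, hmem⟩ := ih _ (L.jdx_lt i h) hj
      have hkdx : L.kdx i h = k :=
        L.distinct _ _ ((L.a_kdx i h).trans hka.symm) ((L.b_kdx i h).trans hkb.symm)
      have hvert : (L.walk i).map Prod.fst =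
          (L.walk (L.jdx i h)).map Prod.fst ++ [L.b (L.jdx i h)] := by
        rw [L.walk_of_ne i h, hkdx, L.walk_of_eq k hk, L.b_jdx i h, ← hka]
        simp
      rw [hvert]
      rw [L.a_jdx i h] at hmem
      constructor
      · refine hnodup.append (List.nodup_singleton _) (List.disjoint_singleton.2 fun hb => ?_)
        obtain hb | ⟨j, hji, hja, hjb⟩ := hmem _ hb
        · exact L.ne i hb.symm
        · exact (hji.trans_lt (L.jdx_lt i h)).ne (L.distinct _ _ hja hjb)
      · intro x hx
        obtain hx | hx := List.mem_append.1 hx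
        · exact (hmem x hx).imp_right fun ⟨j, hj, he⟩ => ⟨j, hj.trans (L.jdx_lt i h).le, he⟩
        · exact Or.inr ⟨i, le_rfl, rfl, (List.mem_singleton.1 hx).symm⟩

/-- In an in rooted pair `(aᵢ,bᵢ)`, every vertex `x ≠ bᵢ` of the walk is the tail of a
transitive arc `(x,bᵢ)` occurring no later than `i`, so the walk is a path. -/
theorem InRooted.nodup_and_mem (L : WitnessList V) (i : Fin L.K) (hi : L.InRooted i) :
    ((L.walk i).map Prod.fst ++ [L.b i]).Nodup ∧
      ∀ x ∈ (L.walk i).map Prod.fst ++ [L.b i],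
        x = L.b i ∨ ∃ j ≤ i, L.a j = x ∧ L.b j = L.b i := by
  induction i using WellFoundedLT.induction with
  | ind i ih =>
    by_cases h : L.w i = L.b i
    · rw [L.walk_of_eq i h]
      refine ⟨by simpa using L.ne i, fun x hx => ?_⟩
      have hx' : x = L.a i ∨ x = L.b i := by simpa using hx
      exact hx'.symm.imp_right fun ha => ⟨i, le_rfl, ha.symm, rfl⟩
    · rw [InRooted, dif_neg h] at hi
      obtain ⟨⟨j, hj, hja, hjb⟩, hk⟩ := hi
      obtain ⟨hnodup, hmem⟩ := ih _ (L.kdx_lt i h) hk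
      have hjdx : L.jdx i h = j :=
        L.distinct _ _ ((L.a_jdx i h).trans hja.symm) ((L.b_jdx i h).trans hjb.symm)
      have hvert : (L.walk i).map Prod.fst ++ [L.b i] =
          L.a i :: ((L.walk (L.kdx i h)).map Prod.fst ++ [L.b (L.kdx i h)]) := by
        rw [L.walk_of_ne i h, hjdx, L.walk_of_eq j hj, L.b_kdx i h, ← hja]
        simp
      rw [hvert]
      rw [L.b_kdx i h] at hmem hnodup ⊢
      constructor
      · refine List.nodup_cons.2 ⟨fun ha => ?_, hnodup⟩
        obtain ha | ⟨k, hki, hka, hkb⟩ := hmem _ ha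
        · exact L.ne i ha
        · exact (hki.trans_lt (L.kdx_lt i h)).ne (L.distinct _ _ hka hkb)
      · intro x hx
        obtain rfl | hx := List.mem_cons.1 hx
        · exact Or.inr ⟨i, le_rfl, rfl, rfl⟩
        · exact (hmem x hx).imp_right fun ⟨k, hk, he⟩ => ⟨k, hk.trans (L.kdx_lt i h).le, he⟩

end WitnessList

/-- Every rooted witness list is path-structured: if every transitive arc of `L`
is out rooted or in rooted, then for every index `i` the walk `walk_L(aᵢ,bᵢ)`
visits pairwise distinct vertices, i.e. it is a path. -/
theorem rooted_implies_path_structured {V : Type} [Fintype V]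
    (L : WitnessList V) (hR : ∀ i, L.OutRooted i ∨ L.InRooted i) (i : Fin L.K) :
    ((L.walk i).map Prod.fst ++ [L.b i]).Nodup := by
  exact (hR i).elim (fun h => (h.nodup_and_mem L i).1) (fun h => (h.nodup_and_mem L i).1)
end
end

section
/- Let T be a rooted spanning tree of depth at most D on a finite set V and let F ⊆ V×V respect T. Then size_T(F) ≤ min{ D·|F| , 2·Σ_{a∈V} |anc_T(a)|² }. -/
open scoped Classical

noncomputable section

/-- A rooted spanning tree on a finite node set `V`, given by its root and the
parent function: every node reaches the root by iterating `parent`. -/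
structure TreeOrder (V : Type) [Fintype V] where
  root : V
  parent : V → V
  parent_root : parent root = root
  reaches_root : ∀ v : V, ∃ n : ℕ, parent^[n] v = root

namespace TreeOrder

variable {V : Type} [Fintype V]

/-- The set of ancestors of `a` (including `a` itself). -/
def anc (T : TreeOrder V) (a : V) : Set V := {x | ∃ n : ℕ, T.parent^[n] a = x}

/-- The set of descendants of `a` (including `a` itself). -/
def desc (T : TreeOrder V) (a : V) : Set V := {x | a ∈ T.anc x}

/-- The set of nodes related to `a`: its ancestors and descendants. -/
def rel (T : TreeOrder V) (a : V) : Set V := T.anc a ∪ T.desc a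

/-- A pair respects `T` if its endpoints are related in `T`. -/
def Respects (T : TreeOrder V) (p : V × V) : Prop := p.1 ∈ T.rel p.2

/-- The common ancestors `anc_T(u,v) = anc_T(u) ∩ anc_T(v)`. -/
def ancPair (T : TreeOrder V) (u v : V) : Set V := T.anc u ∩ T.anc v

/-- The size of `F` relative to `T`: `Σ_{(a,b)∈F} |anc_T(a,b)|`. -/
def size (T : TreeOrder V) (F : Finset (V × V)) : ℕ :=
  ∑ p ∈ F, (T.ancPair p.1 p.2).ncard

/-- `T` has depth at most `D`: every node has at most `D` ancestors. -/
def DepthLE (T : TreeOrder V) (D : ℕ) : Prop := ∀ a : V, (T.anc a).ncard ≤ D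

/-- Of a pair of related nodes, the one that is a descendant of the other. -/
def cdesc (T : TreeOrder V) (a b : V) : V := if a ∈ T.desc b then a else b

end TreeOrder

namespace TreeOrder

variable {V : Type} [Fintype V]

theorem ncard_ancPair_le_left (T : TreeOrder V) (a b : V) :
    (T.ancPair a b).ncard ≤ (T.anc a).ncard :=
  Set.ncard_le_ncard Set.inter_subset_left (Set.toFinite _)

theorem ncard_ancPair_le_right (T : TreeOrder V) (a b : V) :
    (T.ancPair a b).ncard ≤ (T.anc b).ncard :=
  Set.ncard_le_ncard Set.inter_subset_right (Set.toFinite _)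

theorem sum_ite_mem_anc (T : TreeOrder V) (a : V) :
    ∑ b : V, (if b ∈ T.anc a then (T.anc a).ncard else 0) = (T.anc a).ncard ^ 2 := by
  rw [← Finset.sum_filter, Finset.sum_const, smul_eq_mul, sq, Set.ncard_eq_toFinset_card',
    ← Set.filter_mem_univ_eq_toFinset]

theorem size_le_mul_card (T : TreeOrder V) {D : ℕ} (hD : T.DepthLE D) (F : Finset (V × V)) :
    T.size F ≤ D * F.card := by
  rw [mul_comm, ← smul_eq_mul]
  exact Finset.sum_le_card_nsmul _ _ _ fun p _ =>
    (T.ncard_ancPair_le_left p.1 p.2).trans (hD p.1)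

theorem ncard_ancPair_le_of_respects (T : TreeOrder V) {p : V × V} (hp : T.Respects p) :
    (T.ancPair p.1 p.2).ncard ≤
      (if p.2 ∈ T.anc p.1 then (T.anc p.1).ncard else 0) +
        (if p.1 ∈ T.anc p.2 then (T.anc p.2).ncard else 0) := by
  rcases hp with h | h
  · rw [if_pos h]
    exact (T.ncard_ancPair_le_right _ _).trans (Nat.le_add_left _ _)
  · rw [if_pos (show p.2 ∈ T.anc p.1 from h)]
    exact (T.ncard_ancPair_le_left _ _).trans (Nat.le_add_right _ _)

theorem size_le_two_mul_sum_sq (T : TreeOrder V) {F : Finset (V × V)}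
    (hF : ∀ p ∈ F, T.Respects p) :
    T.size F ≤ 2 * ∑ a : V, (T.anc a).ncard ^ 2 := by
  calc T.size F
      ≤ ∑ p ∈ F, ((if p.2 ∈ T.anc p.1 then (T.anc p.1).ncard else 0) +
          (if p.1 ∈ T.anc p.2 then (T.anc p.2).ncard else 0)) :=
        Finset.sum_le_sum fun p hp => T.ncard_ancPair_le_of_respects (hF p hp)
    _ ≤ ∑ p : V × V, ((if p.2 ∈ T.anc p.1 then (T.anc p.1).ncard else 0) +
          (if p.1 ∈ T.anc p.2 then (T.anc p.2).ncard else 0)) :=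
        Finset.sum_le_sum_of_subset (Finset.subset_univ F)
    _ = 2 * ∑ a : V, (T.anc a).ncard ^ 2 := by
        rw [Finset.sum_add_distrib, Fintype.sum_prod_type, Fintype.sum_prod_type_right, two_mul]
        simp only [sum_ite_mem_anc]

end TreeOrder

/-- Relative tree size bound: for a depth-`D` rooted spanning tree `T` and a
tree-respecting set of pairs `F`,
`size_T(F) ≤ min( D·|F| , 2·Σ_{a∈V} |anc_T(a)|² )`. -/
theorem size_le_min {V : Type} [Fintype V]
    (T : TreeOrder V) (D : ℕ) (hD : T.DepthLE D)
    (F : Finset (V × V)) (hF : ∀ p ∈ F, T.Respects p) :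
    T.size F ≤ min (D * F.card) (2 * ∑ a : V, (T.anc a).ncard ^ 2) :=
  le_min (T.size_le_mul_card hD F) (T.size_le_two_mul_sum_sq hF)
end
end

section
/- Let T be a rooted spanning tree on a finite set V, let E ⊆ V×V respect T, and suppose v_0 = u, v_1, …, v_k = v is a directed path with (v_{i−1},v_i) ∈ E for all i ∈ [k]. Then there exists an index j ∈ {0,…,k} such that a := v_j ∈ anc_T(u,v) and every node v_i of the path lies in desc_T(a); in particular there is a directed path from u to a and a directed path from a to v using only arcs in E[desc_T(a)]. -/
open scoped Classical

noncomputable section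

namespace TreeOrder

variable {V : Type} [Fintype V]

theorem mem_anc_self (T : TreeOrder V) (a : V) : a ∈ T.anc a := ⟨0, rfl⟩

theorem mem_anc_trans (T : TreeOrder V) {a b c : V} (hab : a ∈ T.anc b) (hbc : b ∈ T.anc c) :
    a ∈ T.anc c := by
  obtain ⟨m, rfl⟩ := hab
  obtain ⟨n, rfl⟩ := hbc
  exact ⟨m + n, Function.iterate_add_apply _ _ _ _⟩

/-- Any two ancestors of a node are comparable. -/
theorem mem_anc_or_mem_anc (T : TreeOrder V) {a b c : V} (ha : a ∈ T.anc c) (hb : b ∈ T.anc c) :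
    a ∈ T.anc b ∨ b ∈ T.anc a := by
  obtain ⟨m, rfl⟩ := ha
  obtain ⟨n, rfl⟩ := hb
  rcases le_total m n with h | h
  · exact Or.inr ⟨n - m, by rw [← Function.iterate_add_apply, Nat.sub_add_cancel h]⟩
  · exact Or.inl ⟨m - n, by rw [← Function.iterate_add_apply, Nat.sub_add_cancel h]⟩

/-- A sequence whose consecutive nodes are related has a node that is an ancestor of all others. -/
theorem exists_forall_mem_desc (T : TreeOrder V) {k : ℕ} (v : Fin (k + 1) → V)
    (h : ∀ i : Fin k, v i.castSucc ∈ T.rel (v i.succ)) :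
    ∃ j, ∀ i, v i ∈ T.desc (v j) := by
  suffices H : ∀ m : Fin (k + 1), ∃ j, ∀ i ≤ m, v i ∈ T.desc (v j) by
    obtain ⟨j, hj⟩ := H (Fin.last k)
    exact ⟨j, fun i => hj i (Fin.le_last i)⟩
  intro m
  induction m using Fin.induction with
  | zero =>
    refine ⟨0, fun i hi => ?_⟩
    rw [Fin.le_zero_iff.mp hi]
    exact T.mem_anc_self _
  | succ m ih =>
    obtain ⟨j, hj⟩ := ih
    have extend (h' : v j ∈ T.anc (v m.succ)) : ∀ i ≤ m.succ, v i ∈ T.desc (v j) := by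
      intro i hi
      rcases hi.eq_or_lt with rfl | hlt
      · exact h'
      · exact hj i (Fin.le_castSucc_iff.mpr hlt)
    have hjm : v j ∈ T.anc (v m.castSucc) := hj _ le_rfl
    rcases h m with hm | hm
    · exact ⟨j, extend (T.mem_anc_trans hjm hm)⟩
    · rcases T.mem_anc_or_mem_anc hjm hm with hc | hc
      · exact ⟨j, extend hc⟩
      · refine ⟨m.succ, fun i hi => ?_⟩
        rcases hi.eq_or_lt with rfl | hlt
        · exact T.mem_anc_self _
        · exact T.mem_anc_trans hc (hj i (Fin.le_castSucc_iff.mpr hlt))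

end TreeOrder

/-- Along a sequence whose consecutive terms are related by `r`, earlier terms reach later ones. -/
theorem Fin.reflTransGen_of_le {α : Type*} {r : α → α → Prop} {k : ℕ} (v : Fin (k + 1) → α)
    (h : ∀ i : Fin k, r (v i.castSucc) (v i.succ)) {a b : Fin (k + 1)} (hab : a ≤ b) :
    Relation.ReflTransGen r (v a) (v b) := by
  induction b using Fin.induction with
  | zero => rw [Fin.le_zero_iff.mp hab]
  | succ b ih =>
    rcases hab.eq_or_lt with rfl | hlt
    · exact .refl
    · exact (ih (Fin.le_castSucc_iff.mpr hlt)).tail (h b)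

/-- Paths through a common ancestor: if all arcs of `E` respect `T` and
`v 0, v 1, …, v k` is a directed path on arcs of `E`, then some node `a = v j`
is a common ancestor of the endpoints, all nodes of the path are descendants of
`a`, and there are directed paths from `v 0` to `a` and from `a` to `v k`
using only arcs of `E[desc_T(a)]`. -/
theorem path_through_common_ancestor {V : Type} [Fintype V]
    (T : TreeOrder V) (E : Set (V × V)) (hE : ∀ p ∈ E, T.Respects p)
    (k : ℕ) (v : Fin (k + 1) → V)
    (hpath : ∀ i : Fin k, (v i.castSucc, v i.succ) ∈ E) :
    ∃ j : Fin (k + 1),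
      v j ∈ T.ancPair (v 0) (v (Fin.last k)) ∧
      (∀ i, v i ∈ T.desc (v j)) ∧
      Relation.ReflTransGen
        (fun x y => (x, y) ∈ E ∧ x ∈ T.desc (v j) ∧ y ∈ T.desc (v j)) (v 0) (v j) ∧
      Relation.ReflTransGen
        (fun x y => (x, y) ∈ E ∧ x ∈ T.desc (v j) ∧ y ∈ T.desc (v j)) (v j) (v (Fin.last k)) := by
  obtain ⟨j, hj⟩ := T.exists_forall_mem_desc v fun i => hE _ (hpath i)
  have hstep (i : Fin k) : (v i.castSucc, v i.succ) ∈ E ∧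
      v i.castSucc ∈ T.desc (v j) ∧ v i.succ ∈ T.desc (v j) :=
    ⟨hpath i, hj _, hj _⟩
  exact ⟨j, ⟨hj 0, hj (Fin.last k)⟩, hj,
    Fin.reflTransGen_of_le (r := fun x y => (x, y) ∈ E ∧ x ∈ T.desc (v j) ∧ y ∈ T.desc (v j))
      v hstep (Fin.zero_le j),
    Fin.reflTransGen_of_le (r := fun x y => (x, y) ∈ E ∧ x ∈ T.desc (v j) ∧ y ∈ T.desc (v j))
      v hstep (Fin.le_last j)⟩
end
end

section
/- Let T be a rooted spanning tree of depth at most D on a finite set V, let E ⊆ V×V respect T with a ≠ b for every (a,b) ∈ E, and let S ⊆ V. Define E_* := {(a,b) : a ≠ b, and there is a directed path from a to b using only arcs of E[desc_T(a)], or a directed path from a to b using only arcs of E[desc_T(b)]}, V' := ∪_{a∈S} anc_T(a), and E' := {(a,b) ∈ E_* : cdesc_T(a,b) ∈ S}. Then S ⊆ V' ⊆ V, E' ⊆ E^tr with both endpoints of every pair in E' lying in V', and (E')^tr[S] = E^tr[S]; that is, (V',E') is a transitive cover of S in (V,E). Moreover |E'| ≤ 2·Σ_{a∈S} |anc_T(a)|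 ≤ 2D|S|. -/
open scoped Classical

noncomputable section

/-- The transitive closure of a set of ordered node pairs: all pairs `(i,j)` with
`i ≠ j` joined by a directed path of pairs from `F`. -/
def transClosure {V : Type} (F : Set (V × V)) : Set (V × V) :=
  {p | p.1 ≠ p.2 ∧ Relation.TransGen (fun a b => (a, b) ∈ F) p.1 p.2}

namespace TreeOrder

variable {V : Type} [Fintype V] (T : TreeOrder V)

theorem self_mem_anc (a : V) : a ∈ T.anc a := ⟨0, rfl⟩

theorem self_mem_desc (a : V) : a ∈ T.desc a := T.self_mem_anc a

variable {T}

theorem anc_trans {a b c : V} (hab : a ∈ T.anc b) (hbc : b ∈ T.anc c) : a ∈ T.anc c := by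
  obtain ⟨m, rfl⟩ := hab
  obtain ⟨n, rfl⟩ := hbc
  exact ⟨m + n, Function.iterate_add_apply _ _ _ _⟩

theorem desc_subset_desc {a b : V} (h : b ∈ T.desc a) : T.desc b ⊆ T.desc a :=
  fun _ hx => anc_trans h hx

/-- The ancestors of a node form a chain. -/
theorem anc_total {a b c : V} (ha : a ∈ T.anc c) (hb : b ∈ T.anc c) :
    a ∈ T.anc b ∨ b ∈ T.anc a := by
  obtain ⟨m, rfl⟩ := ha
  obtain ⟨n, rfl⟩ := hb
  rcases le_total m n with h | h
  · exact .inr ⟨n - m, by rw [← Function.iterate_add_apply, Nat.sub_add_cancel h]⟩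
  · exact .inl ⟨m - n, by rw [← Function.iterate_add_apply, Nat.sub_add_cancel h]⟩

theorem anc_antisymm {a b : V} (hab : a ∈ T.anc b) (hba : b ∈ T.anc a) : a = b := by
  obtain ⟨m, hm⟩ := hab
  obtain ⟨n, hn⟩ := hba
  rcases Nat.eq_zero_or_pos m with rfl | hpos
  · exact hm.symm
  have hroot (k : ℕ) : T.parent^[k] T.root = T.root := Function.iterate_fixed T.parent_root k
  obtain ⟨r, hr⟩ := T.reaches_root b
  have hper : T.parent^[n + m] b = b := by rw [Function.iterate_add_apply, hm, hn]
  have hmul : T.parent^[(n + m) * r] b = b := by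
    rw [Function.iterate_mul]
    exact Function.iterate_fixed hper r
  have hle : r ≤ (n + m) * r := Nat.le_mul_of_pos_left r (by omega)
  have hb : b = T.root := by
    rw [← hmul, ← Nat.sub_add_cancel hle, Function.iterate_add_apply, hr, hroot]
  rw [← hm, hb, hroot]

theorem cdesc_of_mem_desc_left {a b : V} (h : a ∈ T.desc b) : T.cdesc a b = a := if_pos h

theorem cdesc_of_mem_desc_right {a b : V} (h : b ∈ T.desc a) : T.cdesc a b = b := by
  unfold cdesc
  split_ifs with hab
  · exact anc_antisymm h hab
  · rfl

/-- The arc relation of the restriction `E[desc_T(m)]`. -/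
def DescArc (T : TreeOrder V) (E : Set (V × V)) (m a b : V) : Prop :=
  (a, b) ∈ E ∧ a ∈ T.desc m ∧ b ∈ T.desc m

variable {E : Set (V × V)}

theorem DescArc.mono {m n a b : V} (h : m ∈ T.desc n) (hab : T.DescArc E m a b) :
    T.DescArc E n a b :=
  ⟨hab.1, desc_subset_desc h hab.2.1, desc_subset_desc h hab.2.2⟩

theorem left_mem_desc_of_transGen {m a b : V} (h : Relation.TransGen (T.DescArc E m) a b) :
    a ∈ T.desc m := by
  obtain ⟨c, hac, -⟩ := Relation.TransGen.head'_iff.1 h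
  exact hac.2.1

theorem right_mem_desc_of_transGen {m a b : V} (h : Relation.TransGen (T.DescArc E m) a b) :
    b ∈ T.desc m := by
  obtain ⟨c, -, hcb⟩ := Relation.TransGen.tail'_iff.1 h
  exact hcb.2.2

/-- Every path whose arcs respect `T` passes through a common ancestor `m` of all its nodes. -/
theorem exists_reflTransGen_descArc (hE : ∀ p ∈ E, T.Respects p) {i j : V}
    (h : Relation.ReflTransGen (fun a b => (a, b) ∈ E) i j) :
    ∃ m, j ∈ T.desc m ∧ Relation.ReflTransGen (T.DescArc E m) i m ∧
      Relation.ReflTransGen (T.DescArc E m) m j := by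
  induction h with
  | refl => exact ⟨i, T.self_mem_desc i, .refl, .refl⟩
  | @tail b c _ hbc ih =>
    obtain ⟨m, hbm, him, hmb⟩ := ih
    have extend (hc : c ∈ T.desc m) : ∃ m, c ∈ T.desc m ∧
        Relation.ReflTransGen (T.DescArc E m) i m ∧ Relation.ReflTransGen (T.DescArc E m) m c :=
      ⟨m, hc, him, hmb.tail ⟨hbc, hbm, hc⟩⟩
    rcases hE _ hbc with hb | hb
    · exact extend (desc_subset_desc hbm hb)
    · rcases anc_total hbm hb with hmc | hcm
      · exact extend hmc
      · have hmono {a d : V} (h : Relation.ReflTransGen (T.DescArc E m) a d) :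
            Relation.ReflTransGen (T.DescArc E c) a d :=
          Relation.ReflTransGen.mono (fun _ _ => DescArc.mono hcm) _ _ h
        exact ⟨c, T.self_mem_desc c,
          ((hmono him).trans (hmono hmb)).tail ⟨hbc, hb, T.self_mem_desc c⟩, .refl⟩

/-- The pairs `(a,b)` joined by a path in `E[desc_T(a)]` or in `E[desc_T(b)]`. -/
def descClosure (T : TreeOrder V) (E : Set (V × V)) : Set (V × V) :=
  {p | p.1 ≠ p.2 ∧ (Relation.TransGen (T.DescArc E p.1) p.1 p.2 ∨
    Relation.TransGen (T.DescArc E p.2) p.1 p.2)}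

/-- The pairs of `descClosure` whose lower endpoint lies in `S`. -/
def coverArcs (T : TreeOrder V) (E : Set (V × V)) (S : Set V) : Set (V × V) :=
  {p ∈ T.descClosure E | T.cdesc p.1 p.2 ∈ S}

variable {S : Set V}

theorem coverArcs_subset_transClosure : T.coverArcs E S ⊆ transClosure E := by
  rintro p ⟨⟨hp, h⟩, -⟩
  refine ⟨hp, ?_⟩
  rcases h with h | h <;> exact Relation.TransGen.mono (fun _ _ h => h.1) _ _ h

theorem mem_or_mem_of_mem_coverArcs {p : V × V} (hp : p ∈ T.coverArcs E S) :
    (p.1 ∈ S ∧ p.2 ∈ T.anc p.1) ∨ (p.2 ∈ S ∧ p.1 ∈ T.anc p.2) := by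
  obtain ⟨⟨-, h | h⟩, hS⟩ := hp
  · have hd := right_mem_desc_of_transGen h
    exact .inr ⟨cdesc_of_mem_desc_right hd ▸ hS, hd⟩
  · have hd := left_mem_desc_of_transGen h
    exact .inl ⟨cdesc_of_mem_desc_left hd ▸ hS, hd⟩

theorem mem_coverArcs_of_left {a b : V} (hne : a ≠ b) (ha : a ∈ S)
    (h : Relation.TransGen (T.DescArc E b) a b) : (a, b) ∈ T.coverArcs E S :=
  ⟨⟨hne, .inr h⟩, (cdesc_of_mem_desc_left (left_mem_desc_of_transGen h)).symm ▸ ha⟩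

theorem mem_coverArcs_of_right {a b : V} (hne : a ≠ b) (hb : b ∈ S)
    (h : Relation.TransGen (T.DescArc E a) a b) : (a, b) ∈ T.coverArcs E S :=
  ⟨⟨hne, .inl h⟩, (cdesc_of_mem_desc_right (right_mem_desc_of_transGen h)).symm ▸ hb⟩

theorem mem_transClosure_coverArcs_iff (hE : ∀ p ∈ E, T.Respects p) {p : V × V}
    (h₁ : p.1 ∈ S) (h₂ : p.2 ∈ S) :
    p ∈ transClosure (T.coverArcs E S) ↔ p ∈ transClosure E := by
  refine ⟨fun ⟨hp, h⟩ => ⟨hp, ?_⟩, fun ⟨hp, h⟩ => ⟨hp, ?_⟩⟩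
  · exact Relation.TransGen.closed (fun _ _ h => (coverArcs_subset_transClosure h).2) _ _ h
  · obtain ⟨m, -, him, hmj⟩ := exists_reflTransGen_descArc hE h.to_reflTransGen
    have him' : Relation.ReflTransGen (fun a b => (a, b) ∈ T.coverArcs E S) p.1 m := by
      rcases Relation.reflTransGen_iff_eq_or_transGen.1 him with rfl | h
      · exact .refl
      · by_cases hne : p.1 = m
        · exact hne ▸ .refl
        · exact .single (mem_coverArcs_of_left hne h₁ h)
    have hmj' : Relation.ReflTransGen (fun a b => (a, b) ∈ T.coverArcs E S) m p.2 := by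
      rcases Relation.reflTransGen_iff_eq_or_transGen.1 hmj with h | h
      · exact h ▸ .refl
      · by_cases hne : m = p.2
        · exact hne ▸ .refl
        · exact .single (mem_coverArcs_of_right hne h₂ h)
    exact (Relation.reflTransGen_iff_eq_or_transGen.1 (him'.trans hmj')).resolve_left hp.symm

theorem ncard_coverArcs_le (S : Finset V) :
    (T.coverArcs E S).ncard ≤ 2 * ∑ a ∈ S, (T.anc a).ncard := by
  have hsub : T.coverArcs E S ⊆ ⋃ a ∈ S, (Prod.mk a '' T.anc a ∪ (·, a) '' T.anc a) := by
    rintro ⟨a, b⟩ hp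
    simp only [Set.mem_iUnion]
    rcases mem_or_mem_of_mem_coverArcs hp with ⟨hS, hanc⟩ | ⟨hS, hanc⟩
    · exact ⟨a, hS, .inl ⟨b, hanc, rfl⟩⟩
    · exact ⟨b, hS, .inr ⟨a, hanc, rfl⟩⟩
  calc (T.coverArcs E S).ncard
      ≤ (⋃ a ∈ S, (Prod.mk a '' T.anc a ∪ (·, a) '' T.anc a)).ncard := Set.ncard_le_ncard hsub
    _ ≤ ∑ a ∈ S, (Prod.mk a '' T.anc a ∪ (·, a) '' T.anc a).ncard :=
        S.set_ncard_biUnion_le _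
    _ ≤ ∑ a ∈ S, 2 * (T.anc a).ncard := by
        refine Finset.sum_le_sum fun a _ => (Set.ncard_union_le _ _).trans ?_
        rw [two_mul]
        exact add_le_add (Set.ncard_image_le (Set.toFinite _)) (Set.ncard_image_le (Set.toFinite _))
    _ = 2 * ∑ a ∈ S, (T.anc a).ncard := (Finset.mul_sum _ _ _).symm

end TreeOrder

/-- Sparse transitive covers from bounded tree-depth: with
`E_* = {(a,b) : a ≠ b, a reaches b in E[desc_T(a)] or in E[desc_T(b)]}`,
`V' = ∪_{a∈S} anc_T(a)` and `E' = {(a,b) ∈ E_* : cdesc_T(a,b) ∈ S}`, the pair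
`(V',E')` is a transitive cover of `S` in `(V,E)`, of sparsity at most
`2·Σ_{a∈S}|anc_T(a)| ≤ 2·D·|S|`. -/
theorem tree_depth_transitive_cover {V : Type} [Fintype V] [DecidableEq V]
    (T : TreeOrder V) (D : ℕ) (hD : T.DepthLE D)
    (E : Set (V × V)) (hE : ∀ p ∈ E, T.Respects p) (hne : ∀ p ∈ E, p.1 ≠ p.2)
    (S : Finset V)
    (Estar : Set (V × V))
    (hEstar : Estar = {p | p.1 ≠ p.2 ∧
      (Relation.TransGen
        (fun a b => (a, b) ∈ E ∧ a ∈ T.desc p.1 ∧ b ∈ T.desc p.1) p.1 p.2 ∨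
       Relation.TransGen
        (fun a b => (a, b) ∈ E ∧ a ∈ T.desc p.2 ∧ b ∈ T.desc p.2) p.1 p.2)})
    (V' : Set V) (hV' : V' = ⋃ a ∈ S, T.anc a)
    (E' : Set (V × V)) (hE' : E' = {p ∈ Estar | T.cdesc p.1 p.2 ∈ S}) :
    (↑S ⊆ V') ∧
    E' ⊆ transClosure E ∧
    (∀ p ∈ E', p.1 ∈ V' ∧ p.2 ∈ V') ∧
    (∀ p : V × V, p.1 ∈ S → p.2 ∈ S → (p ∈ transClosure E' ↔ p ∈ transClosure E)) ∧
    E'.ncard ≤ 2 * ∑ a ∈ S, (T.anc a).ncard ∧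
    2 * ∑ a ∈ S, (T.anc a).ncard ≤ 2 * D * S.card := by
  obtain rfl : E' = T.coverArcs E S := by
    subst hE' hEstar
    rfl
  subst hV'
  refine ⟨fun a ha => Set.mem_biUnion ha (T.self_mem_anc a),
    TreeOrder.coverArcs_subset_transClosure, fun p hp => ?_,
    fun p h₁ h₂ => TreeOrder.mem_transClosure_coverArcs_iff hE h₁ h₂,
    TreeOrder.ncard_coverArcs_le S, ?_⟩
  · rcases TreeOrder.mem_or_mem_of_mem_coverArcs hp with ⟨hS, hanc⟩ | ⟨hS, hanc⟩
    · exact ⟨Set.mem_biUnion hS (T.self_mem_anc _), Set.mem_biUnion hS hanc⟩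
    · exact ⟨Set.mem_biUnion hS hanc, Set.mem_biUnion hS (T.self_mem_anc _)⟩
  · rw [mul_assoc, mul_comm D, ← smul_eq_mul S.card]
    exact Nat.mul_le_mul_left 2 (Finset.sum_le_card_nsmul S _ D fun a _ => hD a)
end
end
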